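/- P¹ is a maximal Poisson subalgebra of Õ: if V is a Poisson subalgebra of P with P¹ ⊆ V ⊆ Õ, then V = P¹ or V = Õ. -/

import Mathlib

open MvPolynomial MeasureTheory

noncomputable section

attribute [local instance] Classical.propDecidable

/-- The Poisson bracket on `ℝ[X₀,X₁,X₂]` associated to the sphere:
`{f,g} = Σ εᵢⱼₖ Xᵢ ∂f/∂Xⱼ ∂g/∂Xₖ` (indices `0,1,2` play the role of `1,2,3`). -/
def pb (f g : MvPolynomial (Fin 3) ℝ) : MvPolynomial (Fin 3) ℝ :=
  X 0 * (pderiv 1 f * pderiv 2 g - pderiv 2 f * pderiv 1 g) +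
  X 1 * (pderiv 2 f * pderiv 0 g - pderiv 0 f * pderiv 2 g) +
  X 2 * (pderiv 0 f * pderiv 1 g - pderiv 1 f * pderiv 0 g)

/-- The ideal generated by `X₀² + X₁² + X₂² - s²`. -/
def sphereIdeal (s : ℝ) : Ideal (MvPolynomial (Fin 3) ℝ) :=
  Ideal.span {X 0 ^ 2 + X 1 ^ 2 + X 2 ^ 2 - C (s ^ 2)}

/-- The Poisson algebra `P` of polynomial functions on the sphere of radius `s`. -/
abbrev SpherePoly (s : ℝ) := MvPolynomial (Fin 3) ℝ ⧸ sphereIdeal s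

/-- The quotient map `ℝ[X₀,X₁,X₂] → P`. -/
def toSphere (s : ℝ) : MvPolynomial (Fin 3) ℝ →+* SpherePoly s :=
  Ideal.Quotient.mk (sphereIdeal s)

/-- The components `S₁, S₂, S₃` of the spin vector (indexed by `Fin 3`). -/
def S (s : ℝ) (i : Fin 3) : SpherePoly s := toSphere s (X i)

/-- A choice of polynomial representative of an element of `P`. -/
def rep (s : ℝ) (p : SpherePoly s) : MvPolynomial (Fin 3) ℝ :=
  (Ideal.Quotient.mk_surjective (I := sphereIdeal s) p).choose

/-- The Poisson bracket descended to `P`.  (It is independent of the choice of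
representatives, since the bracket of any polynomial with the generator
`X₀² + X₁² + X₂² - s²` vanishes identically.) -/
def pbS (s : ℝ) (p q : SpherePoly s) : SpherePoly s :=
  toSphere s (pb (rep s p) (rep s q))

/-- `P¹`, the ℝ-linear span of `{1, S₁, S₂, S₃}` in `P`. -/
def P1 (s : ℝ) : Submodule ℝ (SpherePoly s) :=
  Submodule.span ℝ ({1, S s 0, S s 1, S s 2} : Set (SpherePoly s))

theorem one_mem_P1 (s : ℝ) : (1 : SpherePoly s) ∈ P1 s :=
  Submodule.subset_span (Set.mem_insert _ _)

theorem S_mem_P1 (s : ℝ) (i : Fin 3) : S s i ∈ P1 s := by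
  apply Submodule.subset_span
  fin_cases i <;> simp

/-- The Laplacian on `ℝ[X₀,X₁,X₂]` as a linear map. -/
def laplacian : MvPolynomial (Fin 3) ℝ →ₗ[ℝ] MvPolynomial (Fin 3) ℝ :=
  (pderiv 0).toLinearMap ∘ₗ (pderiv 0).toLinearMap +
  (pderiv 1).toLinearMap ∘ₗ (pderiv 1).toLinearMap +
  (pderiv 2).toLinearMap ∘ₗ (pderiv 2).toLinearMap

/-- Homogeneous harmonic polynomials of degree `l`. -/
def harmonicHomog (l : ℕ) : Submodule ℝ (MvPolynomial (Fin 3) ℝ) :=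
  homogeneousSubmodule (Fin 3) ℝ l ⊓ LinearMap.ker laplacian

/-- `H_l`, the image in `P` of the homogeneous harmonic polynomials of degree `l`. -/
def Hsph (s : ℝ) (l : ℕ) : Submodule ℝ (SpherePoly s) :=
  (harmonicHomog l).map (Ideal.Quotient.mkₐ ℝ (sphereIdeal s)).toLinearMap

/-- `O`, the odd polynomials: the sum of the `H_l` over odd `l`. -/
def Osph (s : ℝ) : Submodule ℝ (SpherePoly s) :=
  ⨆ (l : ℕ) (_ : Odd l), Hsph s l

/-- `Õ = ℝ·1 ⊕ O`. -/
def Otilde (s : ℝ) : Submodule ℝ (SpherePoly s) :=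
  Submodule.span ℝ ({1} : Set (SpherePoly s)) ⊔ Osph s

theorem S_mem_H1 (s : ℝ) (i : Fin 3) : S s i ∈ Hsph s 1 := by
  refine ⟨X i, ⟨isHomogeneous_X _ _, ?_⟩, rfl⟩
  fin_cases i <;> simp [laplacian, pderiv_X]

theorem S_mem_Otilde (s : ℝ) (i : Fin 3) : S s i ∈ Otilde s :=
  Submodule.mem_sup_right
    ((le_iSup₂ (f := fun (l : ℕ) (_ : Odd l) => Hsph s l) 1 odd_one) (S_mem_H1 s i))

theorem one_mem_Otilde (s : ℝ) : (1 : SpherePoly s) ∈ Otilde s :=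
  Submodule.mem_sup_left (Submodule.mem_span_singleton_self 1)

/-- The Hamiltonian derivation `{f, ·}` over an arbitrary coefficient ring. -/
def ham {R : Type*} [CommRing R] (f : MvPolynomial (Fin 3) R) :
    Derivation R (MvPolynomial (Fin 3) R) (MvPolynomial (Fin 3) R) :=
  (X 1 * pderiv 2 f - X 2 * pderiv 1 f) • pderiv 0 +
  (X 2 * pderiv 0 f - X 0 * pderiv 2 f) • pderiv 1 +
  (X 0 * pderiv 1 f - X 1 * pderiv 0 f) • pderiv 2

section Bracket

variable {R : Type*} [CommRing R]

theorem ham_apply (f g : MvPolynomial (Fin 3) R) :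
    ham f g = (X 1 * pderiv 2 f - X 2 * pderiv 1 f) * pderiv 0 g +
      (X 2 * pderiv 0 f - X 0 * pderiv 2 f) * pderiv 1 g +
      (X 0 * pderiv 1 f - X 1 * pderiv 0 f) * pderiv 2 g := by
  simp [ham]

theorem ham_skew (f g : MvPolynomial (Fin 3) R) : ham f g = -ham g f := by
  simp only [ham_apply]; ring

theorem ham_self (f : MvPolynomial (Fin 3) R) : ham f f = 0 := by
  simp only [ham_apply]; ring

theorem ham_add_left (f g h : MvPolynomial (Fin 3) R) : ham (f + g) h = ham f h + ham g h := by
  rw [ham_skew, map_add, ham_skew f, ham_skew g]; ring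

theorem ham_mul_left (f g h : MvPolynomial (Fin 3) R) :
    ham (f * g) h = f * ham g h + g * ham f h := by
  rw [ham_skew, Derivation.leibniz, ham_skew f, ham_skew g]
  simp only [smul_eq_mul]; ring

theorem ham_C_left (a : R) (h : MvPolynomial (Fin 3) R) : ham (C a) h = 0 := by
  simp [ham]

theorem ham_C_right (a : R) (h : MvPolynomial (Fin 3) R) : ham h (C a) = 0 := by
  simp

theorem C_ofNat (n : ℕ) [n.AtLeastTwo] :
    (C (ofNat(n) : R) : MvPolynomial (Fin 3) R) = ofNat(n) :=
  map_ofNat C n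

theorem ham_ofNat_right (n : ℕ) [n.AtLeastTwo] (h : MvPolynomial (Fin 3) R) :
    ham h (ofNat(n) : MvPolynomial (Fin 3) R) = 0 := by
  rw [← C_ofNat, ham_C_right]

theorem ham_pow_left (f h : MvPolynomial (Fin 3) R) (n : ℕ) :
    ham (f ^ n) h = n * f ^ (n - 1) * ham f h := by
  rw [ham_skew, Derivation.leibniz_pow, ham_skew f]
  simp only [smul_eq_mul, nsmul_eq_mul]; ring

theorem ham_pow_right (f h : MvPolynomial (Fin 3) R) (n : ℕ) :
    ham h (f ^ n) = n * f ^ (n - 1) * ham h f := by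
  rw [Derivation.leibniz_pow]
  simp only [smul_eq_mul, nsmul_eq_mul]; ring

theorem ham_mul_right (f g h : MvPolynomial (Fin 3) R) :
    ham h (f * g) = f * ham h g + g * ham h f := by
  rw [Derivation.leibniz]; simp only [smul_eq_mul]

theorem ham_map {R' : Type*} [CommRing R'] (φ : R →+* R') (f g : MvPolynomial (Fin 3) R) :
    ham (map φ f) (map φ g) = map φ (ham f g) := by
  simp [ham_apply, pderiv_map]

/-- The equation of the sphere of squared radius `r`. -/
def sphereEq (r : R) : MvPolynomial (Fin 3) R := X 0 ^ 2 + X 1 ^ 2 + X 2 ^ 2 - C r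

theorem ham_sphereEq (r : R) (f : MvPolynomial (Fin 3) R) : ham f (sphereEq r) = 0 := by
  simp [ham_apply, sphereEq, pderiv_X]; ring

end Bracket

theorem pb_eq_ham (f g : MvPolynomial (Fin 3) ℝ) : pb f g = ham f g := by
  rw [ham_apply, pb]; ring

theorem mem_of_C_mul_mem {U : Submodule ℂ (MvPolynomial (Fin 3) ℂ)} {a : ℂ} (ha : a ≠ 0)
    {f : MvPolynomial (Fin 3) ℂ} (h : C a * f ∈ U) : f ∈ U := by
  rw [← smul_eq_C_mul] at h
  exact (U.smul_mem_iff ha).1 h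

theorem C_mul_mem {U : Submodule ℂ (MvPolynomial (Fin 3) ℂ)} (a : ℂ)
    {f : MvPolynomial (Fin 3) ℂ} (h : f ∈ U) : C a * f ∈ U := by
  rw [← smul_eq_C_mul]
  exact U.smul_mem a h

section Complexification

/-- The complexification of a space of real polynomials. -/
def complexify (W : Submodule ℝ (MvPolynomial (Fin 3) ℝ)) :
    Submodule ℂ (MvPolynomial (Fin 3) ℂ) where
  carrier := {g | ∃ a ∈ W, ∃ b ∈ W,
    g = map Complex.ofRealHom a + C Complex.I * map Complex.ofRealHom b}
  zero_mem' := ⟨0, W.zero_mem, 0, W.zero_mem, by simp⟩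
  add_mem' := by
    rintro _ _ ⟨a, ha, b, hb, rfl⟩ ⟨a', ha', b', hb', rfl⟩
    refine ⟨a + a', W.add_mem ha ha', b + b', W.add_mem hb hb', ?_⟩
    simp only [map_add]; ring
  smul_mem' := by
    rintro c _ ⟨a, ha, b, hb, rfl⟩
    refine ⟨c.re • a - c.im • b, W.sub_mem (W.smul_mem _ ha) (W.smul_mem _ hb),
      c.re • b + c.im • a, W.add_mem (W.smul_mem _ hb) (W.smul_mem _ ha), ?_⟩
    have hI : (C Complex.I : MvPolynomial (Fin 3) ℂ) * C Complex.I = -1 := by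
      rw [← C_mul, Complex.I_mul_I]; simp
    have hc : (C c : MvPolynomial (Fin 3) ℂ) = C (c.re : ℂ) + C (c.im : ℂ) * C Complex.I := by
      rw [← C_mul, ← C_add, Complex.re_add_im]
    simp only [smul_eq_C_mul, map_sub, map_add, map_mul, map_C, Complex.ofRealHom_eq_coe, hc]
    linear_combination (C (c.im : ℂ) * map Complex.ofRealHom b) * hI

variable {W : Submodule ℝ (MvPolynomial (Fin 3) ℝ)}

theorem map_mem_complexify {a : MvPolynomial (Fin 3) ℝ} :
    map Complex.ofRealHom a ∈ complexify W ↔ a ∈ W := by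
  constructor
  · rintro ⟨b, hb, c, -, h⟩
    convert hb
    ext d
    have := congrArg (fun p => (coeff d p).re) h
    simpa [coeff_map] using this
  · exact fun ha => ⟨a, ha, 0, W.zero_mem, by simp⟩

theorem complexify_top : complexify ⊤ = ⊤ := by
  refine eq_top_iff.2 fun p _ => ?_
  induction p using MvPolynomial.induction_on' with
  | monomial d c =>
    have h := (complexify ⊤).smul_mem c
      (map_mem_complexify.2 (Submodule.mem_top (x := (monomial d (1 : ℝ)))))
    simpa [map_monomial, smul_monomial] using h
  | add p q hp hq => exact Submodule.add_mem _ (hp trivial) (hq trivial)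

theorem conj_mem_complexify {g : MvPolynomial (Fin 3) ℂ} (hg : g ∈ complexify W) :
    map (starRingEnd ℂ) g ∈ complexify W := by
  obtain ⟨a, ha, b, hb, rfl⟩ := hg
  refine ⟨a, ha, -b, W.neg_mem hb, ?_⟩
  have h : (starRingEnd ℂ).comp Complex.ofRealHom = Complex.ofRealHom := by ext; simp
  simp [map_map, h]

theorem ham_mem_complexify (hW : ∀ f ∈ W, ∀ g ∈ W, ham f g ∈ W)
    {f g : MvPolynomial (Fin 3) ℂ} (hf : f ∈ complexify W) (hg : g ∈ complexify W) :
    ham f g ∈ complexify W := by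
  obtain ⟨a, ha, b, hb, rfl⟩ := hf
  obtain ⟨a', ha', b', hb', rfl⟩ := hg
  have key : ∀ x ∈ W, ∀ y ∈ W,
      ham (map Complex.ofRealHom x) (map Complex.ofRealHom y) ∈ complexify W := by
    intro x hx y hy
    rw [ham_map]
    exact map_mem_complexify.2 (hW x hx y hy)
  simp only [ham_add_left, ham_mul_left, map_add, ham_mul_right, ham_C_left, ham_C_right,
    mul_zero, add_zero]
  exact add_mem (add_mem (key _ ha _ ha') (C_mul_mem _ (key _ hb _ ha')))
    (C_mul_mem _ (add_mem (key _ ha _ hb') (C_mul_mem _ (key _ hb _ hb'))))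

theorem mul_sphereEq_mem_complexify {r : ℝ} (hW : ∀ f, f * sphereEq r ∈ W)
    (g : MvPolynomial (Fin 3) ℂ) : g * sphereEq (r : ℂ) ∈ complexify W := by
  obtain ⟨a, -, b, -, rfl⟩ : g ∈ complexify ⊤ := complexify_top ▸ Submodule.mem_top
  refine ⟨_, hW a, _, hW b, ?_⟩
  have : map Complex.ofRealHom (sphereEq r) = sphereEq (r : ℂ) := by simp [sphereEq]
  rw [map_mul, map_mul, this]; ring

end Complexification

/-- `v` and `w` are the complex coordinates `X₀ ± i X₁`, in one of the two orders; `c = ±i`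
according to the order. -/
structure LadderPair (v w : MvPolynomial (Fin 3) ℂ) (c : ℂ) : Prop where
  ne_zero : c ≠ 0
  bracket_left : ham v (X 2) = C c * v
  bracket_right : ham w (X 2) = -(C c * w)
  bracket : ham v w = -(2 * C c * X 2)
  mul_eq : v * w = X 0 ^ 2 + X 1 ^ 2

theorem ladderPair : LadderPair (X 0 + C Complex.I * X 1) (X 0 - C Complex.I * X 1) Complex.I := by
  have hI : (C Complex.I : MvPolynomial (Fin 3) ℂ) * C Complex.I = -1 := by
    rw [← C_mul, Complex.I_mul_I]; simp
  refine ⟨Complex.I_ne_zero, ?_, ?_, ?_, ?_⟩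
  · simp [ham_apply, pderiv_X]
    linear_combination -X 1 * hI
  · simp [ham_apply, pderiv_X]
    linear_combination -X 1 * hI
  · simp [ham_apply, pderiv_X]
    ring
  · linear_combination -X 1 ^ 2 * hI

theorem LadderPair.symm {v w : MvPolynomial (Fin 3) ℂ} {c : ℂ} (h : LadderPair v w c) :
    LadderPair w v (-c) where
  ne_zero := neg_ne_zero.2 h.ne_zero
  bracket_left := by rw [h.bracket_right]; simp
  bracket_right := by rw [h.bracket_left]; simp
  bracket := by rw [ham_skew, h.bracket]; simp
  mul_eq := by rw [mul_comm, h.mul_eq]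

theorem LadderPair.mul_eq_sphereEq {v w : MvPolynomial (Fin 3) ℂ} {c : ℂ} (h : LadderPair v w c)
    (r : ℂ) : v * w = C r - X 2 ^ 2 + sphereEq r := by
  rw [h.mul_eq, sphereEq]; ring

/-- `U` is (the preimage in the polynomial ring of) a complex Poisson subalgebra of functions on
the sphere of squared radius `r`, containing the linear functions. -/
structure IsSphereSubalgebra (r : ℂ) (U : Submodule ℂ (MvPolynomial (Fin 3) ℂ)) : Prop where
  ham_mem : ∀ {f g}, f ∈ U → g ∈ U → ham f g ∈ U
  X_mem : ∀ i, X i ∈ U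
  mul_sphereEq_mem : ∀ f, f * sphereEq r ∈ U

namespace IsSphereSubalgebra

variable {r c : ℂ} {U : Submodule ℂ (MvPolynomial (Fin 3) ℂ)} {v w : MvPolynomial (Fin 3) ℂ}

theorem z_mul_pow_mem_pred (hU : IsSphereSubalgebra r U) (hr : r ≠ 0) (hvw : LadderPair v w c)
    (hv : v ∈ U) (hw : w ∈ U) {k : ℕ} (h : X 2 * (v * w) ^ (k + 1) ∈ U) :
    X 2 * (v * w) ^ k ∈ U := by
  have hq := hvw.mul_eq_sphereEq r
  have h1 := hU.ham_mem hv h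
  have e1 : ham v (X 2 * (v * w) ^ (k + 1)) =
      C c * (v * (C (2 * k + 3 : ℂ) * (v * w) ^ (k + 1) - C (2 * (k + 1) * r) * (v * w) ^ k)) +
        (-2 * C c * ((k : MvPolynomial (Fin 3) ℂ) + 1) * v * (v * w) ^ k) * sphereEq r := by
    simp only [ham_mul_right, ham_pow_right, ham_self, hvw.bracket, hvw.bracket_left,
      Nat.add_sub_cancel, map_add, map_mul, map_natCast, Nat.cast_add, Nat.cast_one, map_ofNat,
      map_one]
    linear_combination (-2 * C c * (k + 1) * v * (v * w) ^ k) * hq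
  rw [e1] at h1
  have h2 := mem_of_C_mul_mem hvw.ne_zero ((U.add_mem_iff_left (hU.mul_sphereEq_mem _)).1 h1)
  have h3 := hU.ham_mem hw h2
  have hwv : ham w v = 2 * C c * X 2 := by rw [ham_skew, hvw.bracket]; ring
  have e3 : ham w (v * (C (2 * k + 3 : ℂ) * (v * w) ^ (k + 1) -
        C (2 * (k + 1) * r) * (v * w) ^ k)) =
      C (2 * c * (2 * k + 3) * (k + 2)) * (X 2 * (v * w) ^ (k + 1)) -
        C (4 * c * (k + 1) ^ 2 * r) * (X 2 * (v * w) ^ k) := by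
    rcases k with _ | k <;>
    · simp only [ham_mul_right, ham_pow_right, ham_self, hwv, map_sub, ham_C_right,
        Nat.add_sub_cancel, map_add, map_mul, map_natCast, Nat.cast_add, Nat.cast_one, map_ofNat,
        map_one, map_pow]
      simp [ham_ofNat_right]
      ring
  rw [e3] at h3
  refine mem_of_C_mul_mem ?_ ((U.sub_mem_iff_right (C_mul_mem _ h)).1 h3)
  have : (k + 1 : ℂ) ≠ 0 := Nat.cast_add_one_ne_zero k
  simp [hvw.ne_zero, hr, this]

theorem z_cube_mem (hU : IsSphereSubalgebra r U) (hr : r ≠ 0) (hvw : LadderPair v w c)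
    (hv : v ∈ U) (hw : w ∈ U) {n : ℕ} (hvn : v ^ (n + 2) ∈ U) (hwn : w ^ (n + 2) ∈ U) :
    X 2 ^ 3 ∈ U := by
  have h := hU.ham_mem hvn hwn
  have e : ham (v ^ (n + 2)) (w ^ (n + 2)) =
      C (-(2 * (n + 2) ^ 2 * c)) * (X 2 * (v * w) ^ (n + 1)) := by
    simp only [ham_pow_left, ham_pow_right, hvw.bracket]
    simp [C_ofNat]
    ring
  rw [e] at h
  have hn : (n + 2 : ℂ) ≠ 0 := by exact_mod_cast (show n + 2 ≠ 0 by omega)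
  have h0 : X 2 * (v * w) ^ (n + 1) ∈ U := mem_of_C_mul_mem (by simp [hn, hvw.ne_zero]) h
  have h1 : X 2 * (v * w) ^ (0 + 1) ∈ U := by
    clear h e hn hvn hwn
    induction n with
    | zero => exact h0
    | succ n ih => exact ih (hU.z_mul_pow_mem_pred hr hvw hv hw h0)
  have e1 : (X 2 : MvPolynomial (Fin 3) ℂ) ^ 3 =
      C r * X 2 + X 2 * sphereEq r - X 2 * (v * w) ^ (0 + 1) := by
    rw [hvw.mul_eq_sphereEq r]; ring
  rw [e1]
  exact sub_mem (add_mem (C_mul_mem _ (hU.X_mem 2)) (hU.mul_sphereEq_mem _)) h1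

theorem odd_pow_mem (hU : IsSphereSubalgebra r U) (hvw : LadderPair v w c)
    (hv : v ∈ U) (hz : X 2 ^ 3 ∈ U) (m : ℕ) : v ^ (2 * m + 1) ∈ U := by
  have hzv : ham (X 2) v = -(C c * v) := by rw [ham_skew, hvw.bracket_left]
  have h2 : v ^ 2 * X 2 ∈ U := by
    have h := hU.ham_mem hv (hU.ham_mem hv hz)
    have e : ham v (ham v (X 2 ^ 3)) = C (6 * c ^ 2) * (v ^ 2 * X 2) := by
      simp only [ham_pow_right, ham_mul_right, hvw.bracket_left, ham_self, ham_C_right]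
      simp [ham_ofNat_right, C_ofNat]
      ring
    rw [e] at h
    exact mem_of_C_mul_mem (by simp [hvw.ne_zero]) h
  induction m with
  | zero => simpa using hv
  | succ m ih =>
    have h := hU.ham_mem h2 ih
    have e : ham (v ^ 2 * X 2) (v ^ (2 * m + 1)) =
        C (-((2 * m + 1) * c)) * v ^ (2 * (m + 1) + 1) := by
      simp only [ham_pow_right, ham_mul_left, ham_pow_left, ham_self, hzv]
      simp [C_ofNat]
      ring
    rw [e] at h
    have hm : (2 * m + 1 : ℂ) ≠ 0 := by exact_mod_cast (show 2 * m + 1 ≠ 0 by omega)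
    exact mem_of_C_mul_mem (by simp [hvw.ne_zero, hm]) h

theorem odd_monomial_mem (hU : IsSphereSubalgebra r U) (hvw : LadderPair v w c)
    (hv : v ∈ U) (hw : w ∈ U) (hz : X 2 ^ 3 ∈ U) (m k : ℕ) (hmk : Odd (m + k)) :
    v ^ m * X 2 ^ k ∈ U := by
  have hzv : ham (X 2) v = -(C c * v) := by rw [ham_skew, hvw.bracket_left]
  have hwv : ham w v = 2 * C c * X 2 := by rw [ham_skew, hvw.bracket]; ring
  induction k using Nat.twoStepInduction generalizing m with
  | zero =>
    obtain ⟨n, rfl⟩ := hmk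
    simpa using hU.odd_pow_mem hvw hv hz n
  | one =>
    obtain ⟨n, hn⟩ := hmk
    have h := hU.ham_mem hw (hU.odd_pow_mem hvw hv hz n)
    rw [← hn] at h
    have e : ham w (v ^ (m + 1)) = C (2 * (m + 1) * c) * (v ^ m * X 2 ^ 1) := by
      simp only [ham_pow_right, hwv]
      simp [C_ofNat]
      ring
    rw [e] at h
    have hm : (m + 1 : ℂ) ≠ 0 := Nat.cast_add_one_ne_zero m
    exact mem_of_C_mul_mem (by simp [hvw.ne_zero, hm]) h
  | more k ih0 ih1 =>
    rcases m with _ | m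
    · have h := hU.ham_mem hw (ih1 1 (by convert hmk using 1; ring))
      have e : ham w (v ^ 1 * X 2 ^ (k + 1)) =
          C (c * (k + 3)) * (v ^ 0 * X 2 ^ (k + 2)) - C (c * (k + 1) * r) * (v ^ 0 * X 2 ^ k) +
            (-(C c * ((k : MvPolynomial (Fin 3) ℂ) + 1) * X 2 ^ k)) * sphereEq r := by
        simp only [ham_pow_right, ham_mul_right, hwv, hvw.bracket_right, pow_zero, one_mul,
          Nat.add_sub_cancel, map_add, map_mul, map_natCast, Nat.cast_add, Nat.cast_one,
          map_ofNat, map_one]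
        simp
        linear_combination (-(C c * (k + 1) * X 2 ^ k)) * hvw.mul_eq_sphereEq r
      rw [e] at h
      have h' := (U.add_mem_iff_left (hU.mul_sphereEq_mem _)).1 h
      have h0 := ih0 0 (by rw [← add_assoc, Nat.odd_add] at hmk; simpa using hmk)
      have hk : (k + 3 : ℂ) ≠ 0 := by exact_mod_cast (show k + 3 ≠ 0 by omega)
      exact mem_of_C_mul_mem (by simp [hvw.ne_zero, hk])
        ((U.sub_mem_iff_left (C_mul_mem _ h0)).1 h')
    · have h0 := ih0 (m + 1) (by rw [← add_assoc, Nat.odd_add] at hmk; simpa using hmk)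
      have h := hU.ham_mem hz h0
      have e : ham (X 2 ^ 3) (v ^ (m + 1) * X 2 ^ k) =
          C (-(3 * (m + 1) * c)) * (v ^ (m + 1) * X 2 ^ (k + 2)) := by
        simp only [ham_pow_right, ham_mul_right, ham_pow_left, ham_self, hzv]
        simp [C_ofNat]
        ring
      rw [e] at h
      have hm : (m + 1 : ℂ) ≠ 0 := Nat.cast_add_one_ne_zero m
      exact mem_of_C_mul_mem (by simp [hvw.ne_zero, hm]) h

/-- Raising a weight vector `vᵐ F(X₂)` to a highest weight vector. -/
theorem pow_mem_of_weight_mem (hU : IsSphereSubalgebra r U) (hvw : LadderPair v w c)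
    (hv : v ∈ U) {F : Polynomial ℂ} (hF : F ≠ 0) {m : ℕ}
    (h : v ^ m * Polynomial.aeval (X 2) F ∈ U) : v ^ (m + F.natDegree) ∈ U := by
  induction hd : F.natDegree generalizing F m with
  | zero =>
    rw [Polynomial.natDegree_eq_zero] at hd
    obtain ⟨a, rfl⟩ := hd
    have ha : a ≠ 0 := by rintro rfl; simp at hF
    rw [Polynomial.aeval_C, algebraMap_eq, mul_comm] at h
    exact mem_of_C_mul_mem ha h
  | succ d ih =>
    have hd' : F.derivative.natDegree = d := by simp [Polynomial.natDegree_derivative, hd]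
    have hF' : F.derivative ≠ 0 := by
      intro h0
      have := Polynomial.derivative_eq_zero.1 h0
      omega
    have h1 := hU.ham_mem hv h
    have e : ham v (v ^ m * Polynomial.aeval (X 2) F) =
        C c * (v ^ (m + 1) * Polynomial.aeval (X 2) F.derivative) := by
      rw [ham_mul_right, ham_pow_right, ham_self, Derivation.map_aeval, hvw.bracket_left]
      simp only [smul_eq_mul]
      ring
    rw [e] at h1
    have := ih hF' (mem_of_C_mul_mem hvw.ne_zero h1) hd'
    rwa [add_right_comm, add_assoc] at this

end IsSphereSubalgebra

/-- If a sum of eigenvectors with distinct eigenvalues lies in an invariant subspace, so does every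
summand. -/
theorem Submodule.mem_of_sum_eigenvectors_mem {K M ι : Type*} [Field K] [AddCommGroup M]
    [Module K M] (U : Submodule K M) (T : M →ₗ[K] M) (hT : ∀ x ∈ U, T x ∈ U) {μ : ι → K}
    (hμ : Function.Injective μ) (t : Finset ι) (x : ι → M) (hx : ∀ i, T (x i) = μ i • x i)
    (h : ∑ i ∈ t, x i ∈ U) : ∀ i ∈ t, x i ∈ U := by
  classical
  induction t using Finset.induction_on generalizing x with
  | empty => simp
  | insert a t ha ih =>
    have h1 : ∑ i ∈ t, (μ i - μ a) • x i ∈ U := by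
      have := U.sub_mem (hT _ h) (U.smul_mem (μ a) h)
      rw [Finset.sum_insert ha, map_add, map_sum, hx, smul_add, add_sub_add_left_eq_sub,
        Finset.smul_sum, ← Finset.sum_sub_distrib] at this
      simpa only [hx, sub_smul] using this
    have h2 : ∀ i ∈ t, x i ∈ U := by
      intro i hi
      have := ih (fun i => (μ i - μ a) • x i) (fun i => by rw [map_smul, hx, smul_comm]) h1 i hi
      refine (U.smul_mem_iff (sub_ne_zero.2 fun e => ?_)).1 this
      exact ha (hμ e ▸ hi)
    intro i hi
    rcases Finset.mem_insert.1 hi with rfl | hi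
    · rw [Finset.sum_insert ha] at h
      exact (U.add_mem_iff_left (U.sum_mem h2)).1 h
    · exact h2 i hi

section NormalForm

variable {r c : ℂ} {v w : MvPolynomial (Fin 3) ℂ}

/-- The multiples of the sphere equation. -/
def sphereMultiples (r : ℂ) : Submodule ℂ (MvPolynomial (Fin 3) ℂ) :=
  (Ideal.span {sphereEq r}).restrictScalars ℂ

theorem mul_sphereEq_mem_sphereMultiples (f : MvPolynomial (Fin 3) ℂ) :
    f * sphereEq r ∈ sphereMultiples r :=
  Ideal.mul_mem_left _ _ (Ideal.mem_span_singleton_self _)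

theorem sphereMultiples_le {U : Submodule ℂ (MvPolynomial (Fin 3) ℂ)}
    (hU : ∀ f, f * sphereEq r ∈ U) : sphereMultiples r ≤ U := by
  intro f hf
  obtain ⟨a, rfl⟩ := Ideal.mem_span_singleton'.1 hf
  exact hU a

/-- The span, modulo the sphere equation, of the `vᵐ X₂ᵏ` and `wᵐ X₂ᵏ` with `m + k ≡ n [MOD 2]`. -/
def ladderSpan (r : ℂ) (v w : MvPolynomial (Fin 3) ℂ) (n : ℕ) :
    Submodule ℂ (MvPolynomial (Fin 3) ℂ) :=
  Submodule.span ℂ {f | ∃ m k : ℕ, (m + k) % 2 = n % 2 ∧ (f = v ^ m * X 2 ^ k ∨ f = w ^ m * X 2 ^ k)}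
    ⊔ sphereMultiples r

theorem ladderSpan_comm (n : ℕ) : ladderSpan r v w n = ladderSpan r w v n := by
  simp only [ladderSpan, or_comm]

theorem monomial_mem_ladderSpan {n m k : ℕ} (h : (m + k) % 2 = n % 2) :
    v ^ m * X 2 ^ k ∈ ladderSpan r v w n :=
  Submodule.mem_sup_left (Submodule.subset_span ⟨m, k, h, Or.inl rfl⟩)

theorem mul_mem_ladderSpan {g : MvPolynomial (Fin 3) ℂ} {n : ℕ}
    (hv : ∀ m k : ℕ, (m + k) % 2 = n % 2 → g * (v ^ m * X 2 ^ k) ∈ ladderSpan r v w (n + 1))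
    (hw : ∀ m k : ℕ, (m + k) % 2 = n % 2 → g * (w ^ m * X 2 ^ k) ∈ ladderSpan r v w (n + 1))
    {f : MvPolynomial (Fin 3) ℂ} (hf : f ∈ ladderSpan r v w n) :
    g * f ∈ ladderSpan r v w (n + 1) := by
  suffices ladderSpan r v w n ≤ (ladderSpan r v w (n + 1)).comap (LinearMap.mulLeft ℂ g) from
    this hf
  refine sup_le (Submodule.span_le.2 ?_) (sphereMultiples_le fun a => ?_)
  · rintro _ ⟨m, k, h, rfl | rfl⟩
    · exact hv m k h
    · exact hw m k h
  · rw [Submodule.mem_comap, LinearMap.mulLeft_apply, ← mul_assoc]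
    exact Submodule.mem_sup_right (mul_sphereEq_mem_sphereMultiples _)

theorem ladder_mul_mem_ladderSpan (hvw : LadderPair v w c) {n : ℕ} {f : MvPolynomial (Fin 3) ℂ}
    (hf : f ∈ ladderSpan r v w n) : v * f ∈ ladderSpan r v w (n + 1) := by
  refine mul_mem_ladderSpan (fun m k h => ?_) (fun m k h => ?_) hf
  · rw [← mul_assoc, ← pow_succ']
    exact monomial_mem_ladderSpan (by omega)
  · rcases m with _ | m
    · have e : v * (w ^ 0 * X 2 ^ k) = v ^ 1 * X 2 ^ k := by ring
      rw [e]
      exact monomial_mem_ladderSpan (by omega)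
    · have e : v * (w ^ (m + 1) * X 2 ^ k) =
          C r * (w ^ m * X 2 ^ k) - w ^ m * X 2 ^ (k + 2) + (w ^ m * X 2 ^ k) * sphereEq r := by
        linear_combination (w ^ m * X 2 ^ k) * hvw.mul_eq_sphereEq r
      rw [e]
      refine add_mem (sub_mem (C_mul_mem _ ?_) ?_)
        (Submodule.mem_sup_right (mul_sphereEq_mem_sphereMultiples _)) <;>
      · rw [ladderSpan_comm]
        exact monomial_mem_ladderSpan (by omega)

theorem z_mul_mem_ladderSpan {n : ℕ} {f : MvPolynomial (Fin 3) ℂ}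
    (hf : f ∈ ladderSpan r v w n) : X 2 * f ∈ ladderSpan r v w (n + 1) := by
  refine mul_mem_ladderSpan (fun m k h => ?_) (fun m k h => ?_) hf <;>
  rw [mul_left_comm, ← pow_succ']
  · exact monomial_mem_ladderSpan (by omega)
  · rw [ladderSpan_comm]
    exact monomial_mem_ladderSpan (by omega)

theorem pow_mul_mem_ladderSpan {g : MvPolynomial (Fin 3) ℂ}
    (hg : ∀ n, ∀ f ∈ ladderSpan r v w n, g * f ∈ ladderSpan r v w (n + 1)) (a : ℕ) {n : ℕ}
    {f : MvPolynomial (Fin 3) ℂ} (hf : f ∈ ladderSpan r v w n) :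
    g ^ a * f ∈ ladderSpan r v w (n + a) := by
  induction a with
  | zero => simpa using hf
  | succ a ih =>
    rw [pow_succ', mul_assoc]
    exact hg _ _ ih

/-- The complex coordinate `X₀ + i X₁`. -/
def zUp : MvPolynomial (Fin 3) ℂ := X 0 + C Complex.I * X 1

/-- The complex coordinate `X₀ - i X₁`. -/
def zDown : MvPolynomial (Fin 3) ℂ := X 0 - C Complex.I * X 1

theorem X_mul_mem_ladderSpan (i : Fin 3) (n : ℕ) (f : MvPolynomial (Fin 3) ℂ)
    (hf : f ∈ ladderSpan r zUp zDown n) : X i * f ∈ ladderSpan r zUp zDown (n + 1) := by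
  have hu : zUp * f ∈ ladderSpan r zUp zDown (n + 1) := ladder_mul_mem_ladderSpan ladderPair hf
  have hd : zDown * f ∈ ladderSpan r zUp zDown (n + 1) := by
    rw [ladderSpan_comm] at hf ⊢
    exact ladder_mul_mem_ladderSpan ladderPair.symm hf
  fin_cases i
  · refine mem_of_C_mul_mem (a := 2) two_ne_zero ?_
    have e : C 2 * (X 0 * f) = zUp * f + zDown * f := by
      rw [zUp, zDown, C_ofNat]; ring
    exact e ▸ add_mem hu hd
  · refine mem_of_C_mul_mem (a := 2 * Complex.I) (by simp) ?_
    have e : C (2 * Complex.I) * (X 1 * f) = zUp * f - zDown * f := by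
      rw [zUp, zDown, C_mul, C_ofNat]; ring
    exact e ▸ sub_mem hu hd
  · exact z_mul_mem_ladderSpan hf

theorem mem_ladderSpan_of_isHomogeneous {n : ℕ} {f : MvPolynomial (Fin 3) ℂ}
    (hf : f.IsHomogeneous n) : f ∈ ladderSpan r zUp zDown n := by
  rw [f.as_sum]
  refine Submodule.sum_mem _ fun d hd => ?_
  have hn : d 2 + d 1 + d 0 = n := by
    rw [← hf (mem_support_iff.1 hd)]
    simp [Finsupp.weight_apply, Finsupp.sum_fintype, Fin.sum_univ_three]
    ring
  have h1 : (1 : MvPolynomial (Fin 3) ℂ) ∈ ladderSpan r zUp zDown 0 := by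
    simpa using monomial_mem_ladderSpan (r := r) (v := zUp) (w := zDown) (n := 0) (m := 0)
      (k := 0) rfl
  have h := pow_mul_mem_ladderSpan (X_mul_mem_ladderSpan 0) (d 0)
    (pow_mul_mem_ladderSpan (X_mul_mem_ladderSpan 1) (d 1)
      (pow_mul_mem_ladderSpan (X_mul_mem_ladderSpan 2) (d 2) h1))
  rw [zero_add, hn] at h
  rw [monomial_eq]
  refine C_mul_mem _ ?_
  rw [Finsupp.prod_fintype _ _ (by simp), Fin.prod_univ_three]
  simpa [mul_assoc] using h

/-- The coordinate raising (for `j ≥ 0`) or lowering (for `j < 0`) weights. -/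
def ladderCoord (j : ℤ) : MvPolynomial (Fin 3) ℂ := if 0 ≤ j then zUp else zDown

/-- The polynomials of the form `zUpʲ F(X₂)` for `j ≥ 0`, or `zDown⁻ʲ F(X₂)` for `j ≤ 0`. -/
def weightSpace (j : ℤ) : Submodule ℂ (MvPolynomial (Fin 3) ℂ) :=
  LinearMap.range (LinearMap.mulLeft ℂ (ladderCoord j ^ j.natAbs) ∘ₗ
    (Polynomial.aeval (X 2 : MvPolynomial (Fin 3) ℂ)).toLinearMap)

theorem exists_of_mem_weightSpace {j : ℤ} {f : MvPolynomial (Fin 3) ℂ} (hf : f ∈ weightSpace j) :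
    ∃ F : Polynomial ℂ, f = ladderCoord j ^ j.natAbs * Polynomial.aeval (X 2) F := by
  obtain ⟨F, rfl⟩ := hf
  exact ⟨F, rfl⟩

theorem mem_weightSpace (j : ℤ) (F : Polynomial ℂ) :
    ladderCoord j ^ j.natAbs * Polynomial.aeval (X 2) F ∈ weightSpace j := ⟨F, rfl⟩

theorem ham_z_of_mem_weightSpace {j : ℤ} {f : MvPolynomial (Fin 3) ℂ} (hf : f ∈ weightSpace j) :
    ham (X 2) f = (-(j * Complex.I)) • f := by
  obtain ⟨F, rfl⟩ := exists_of_mem_weightSpace hf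
  have hz : ham (X 2) (ladderCoord j) =
      (if 0 ≤ j then -C Complex.I else C Complex.I) * ladderCoord j := by
    rw [ham_skew]
    unfold ladderCoord
    split_ifs
    · rw [zUp, ladderPair.bracket_left]; ring
    · rw [zDown, ladderPair.bracket_right]; ring
  rw [ham_mul_right, Derivation.map_aeval, ham_self, smul_zero, mul_zero, zero_add, ham_pow_right,
    hz, smul_eq_C_mul]
  split_ifs with hj
  · lift j to ℕ using hj
    rcases j with _ | m
    · simp
    · simp only [Int.natAbs_natCast, Nat.add_sub_cancel]
      simp
      ring
  · obtain ⟨m, rfl⟩ : ∃ m : ℕ, j = -((m : ℤ) + 1) := ⟨(-j - 1).toNat, by omega⟩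
    have : (-((m : ℤ) + 1)).natAbs = m + 1 := by omega
    rw [this]
    simp
    ring

theorem mem_iSup_weightSpace_sup (r : ℂ) (f : MvPolynomial (Fin 3) ℂ) :
    f ∈ (⨆ j, weightSpace j) ⊔ sphereMultiples r := by
  have hle : ∀ n, ladderSpan r zUp zDown n ≤ (⨆ j, weightSpace j) ⊔ sphereMultiples r := by
    intro n
    refine sup_le_sup_right (Submodule.span_le.2 ?_) _
    rintro _ ⟨m, k, -, rfl | rfl⟩
    · refine Submodule.mem_iSup_of_mem (m : ℤ) ?_
      simpa [ladderCoord] using mem_weightSpace m (Polynomial.X ^ k)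
    · refine Submodule.mem_iSup_of_mem (-m : ℤ) ?_
      rcases m with _ | m
      · simpa using mem_weightSpace 0 (Polynomial.X ^ k)
      · have h : ¬ (0 ≤ -((m + 1 : ℕ) : ℤ)) := by omega
        have := mem_weightSpace (-((m + 1 : ℕ) : ℤ)) (Polynomial.X ^ k)
        rwa [ladderCoord, if_neg h, Int.natAbs_neg, Int.natAbs_natCast, map_pow,
          Polynomial.aeval_X] at this
  rw [← sum_homogeneousComponent f]
  exact Submodule.sum_mem _ fun n _ =>
    hle n (mem_ladderSpan_of_isHomogeneous (homogeneousComponent_isHomogeneous n f))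

end NormalForm

namespace IsSphereSubalgebra

variable {r : ℂ} {U : Submodule ℂ (MvPolynomial (Fin 3) ℂ)}

theorem zUp_mem (hU : IsSphereSubalgebra r U) : zUp ∈ U :=
  add_mem (hU.X_mem 0) (C_mul_mem _ (hU.X_mem 1))

theorem zDown_mem (hU : IsSphereSubalgebra r U) : zDown ∈ U :=
  sub_mem (hU.X_mem 0) (C_mul_mem _ (hU.X_mem 1))

theorem exists_weight_mem (hU : IsSphereSubalgebra r U)
    {M : Submodule ℂ (MvPolynomial (Fin 3) ℂ)} (hM : ∀ f, f * sphereEq r ∈ M)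
    {f : MvPolynomial (Fin 3) ℂ} (hf : f ∈ U) (hfM : f ∉ M) :
    ∃ j, ∃ g ∈ weightSpace j, g ∈ U ∧ g ∉ M := by
  obtain ⟨g, hg, q, hq, rfl⟩ := Submodule.mem_sup.1 (mem_iSup_weightSpace_sup r f)
  have hgU : g ∈ U := (U.add_mem_iff_left (sphereMultiples_le hU.mul_sphereEq_mem hq)).1 hf
  have hgM : g ∉ M := fun h => hfM (M.add_mem h (sphereMultiples_le hM hq))
  obtain ⟨x, hx, rfl⟩ := (Submodule.mem_iSup_iff_exists_finsupp _ _).1 hg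
  have hμ : Function.Injective fun j : ℤ => -((j : ℂ) * Complex.I) := by
    intro a b h
    simpa using h
  have hxU := Submodule.mem_of_sum_eigenvectors_mem U (ham (X 2)).toLinearMap
    (fun y hy => hU.ham_mem (hU.X_mem 2) hy) hμ x.support x
    (fun j => ham_z_of_mem_weightSpace (hx j)) hgU
  by_contra! h
  exact hgM (M.sum_mem fun j hj => h j _ (hx j) (hxU j hj))

theorem exists_pow_mem (hU : IsSphereSubalgebra r U)
    {M : Submodule ℂ (MvPolynomial (Fin 3) ℂ)} (hM : ∀ f, f * sphereEq r ∈ M)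
    (hM1 : 1 ∈ M) (hMX : ∀ i, X i ∈ M)
    {f : MvPolynomial (Fin 3) ℂ} (hf : f ∈ U) (hfM : f ∉ M) :
    ∃ n, zUp ^ (n + 2) ∈ U ∨ zDown ^ (n + 2) ∈ U := by
  obtain ⟨j, g, hg, hgU, hgM⟩ := hU.exists_weight_mem hM hf hfM
  obtain ⟨F, rfl⟩ := exists_of_mem_weightSpace hg
  have hF : F ≠ 0 := by
    rintro rfl
    simp at hgM
  have hcoord : ladderCoord j ∈ M := by
    unfold ladderCoord
    split_ifs
    · exact add_mem (hMX 0) (C_mul_mem _ (hMX 1))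
    · exact sub_mem (hMX 0) (C_mul_mem _ (hMX 1))
  have hdeg : 2 ≤ j.natAbs + F.natDegree := by
    by_contra! hlt
    apply hgM
    rw [F.eq_X_add_C_of_natDegree_le_one (by omega)]
    rcases Nat.eq_zero_or_pos j.natAbs with h0 | h0
    · rw [h0]
      simpa [algebraMap_eq] using add_mem (C_mul_mem (F.coeff 1) (hMX 2))
        (C_mul_mem (F.coeff 0) hM1)
    · have h1 : j.natAbs = 1 := by omega
      have h2 : F.coeff 1 = 0 := Polynomial.coeff_eq_zero_of_natDegree_lt (by omega)
      rw [h1, h2]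
      simpa [algebraMap_eq, mul_comm] using C_mul_mem (F.coeff 0) hcoord
  refine ⟨j.natAbs + F.natDegree - 2, ?_⟩
  rw [Nat.sub_add_cancel hdeg]
  unfold ladderCoord at hgU
  split_ifs at hgU
  · exact Or.inl (hU.pow_mem_of_weight_mem ladderPair hU.zUp_mem hF hgU)
  · exact Or.inr (hU.pow_mem_of_weight_mem ladderPair.symm hU.zDown_mem hF hgU)

theorem odd_homogeneous_mem (hU : IsSphereSubalgebra r U) (hr : r ≠ 0)
    (hconj : ∀ f ∈ U, map (starRingEnd ℂ) f ∈ U)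
    {M : Submodule ℂ (MvPolynomial (Fin 3) ℂ)} (hM : ∀ f, f * sphereEq r ∈ M)
    (hM1 : 1 ∈ M) (hMX : ∀ i, X i ∈ M)
    {f : MvPolynomial (Fin 3) ℂ} (hf : f ∈ U) (hfM : f ∉ M)
    {g : MvPolynomial (Fin 3) ℂ} {l : ℕ} (hl : Odd l) (hg : g.IsHomogeneous l) : g ∈ U := by
  have hup : map (starRingEnd ℂ) zUp = zDown := by simp [zUp, zDown, sub_eq_add_neg]
  have hdown : map (starRingEnd ℂ) zDown = zUp := by simp [zUp, zDown]
  obtain ⟨n, hn1, hn2⟩ : ∃ n, zUp ^ (n + 2) ∈ U ∧ zDown ^ (n + 2) ∈ U := by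
    obtain ⟨n, h | h⟩ := hU.exists_pow_mem hM hM1 hMX hf hfM
    · exact ⟨n, h, by simpa [hup] using hconj _ h⟩
    · exact ⟨n, by simpa [hdown] using hconj _ h, h⟩
  have hz : X 2 ^ 3 ∈ U := hU.z_cube_mem hr ladderPair hU.zUp_mem hU.zDown_mem hn1 hn2
  have hle : ladderSpan r zUp zDown l ≤ U := by
    refine sup_le (Submodule.span_le.2 ?_) (sphereMultiples_le hU.mul_sphereEq_mem)
    rintro _ ⟨m, k, h, rfl | rfl⟩
    · exact hU.odd_monomial_mem ladderPair hU.zUp_mem hU.zDown_mem hz m k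
        (Nat.odd_iff.2 (h.trans (Nat.odd_iff.1 hl)))
    · exact hU.odd_monomial_mem ladderPair.symm hU.zDown_mem hU.zUp_mem hz m k
        (Nat.odd_iff.2 (h.trans (Nat.odd_iff.1 hl)))
  exact hle (mem_ladderSpan_of_isHomogeneous hg)

end IsSphereSubalgebra

section Quotient

variable {s : ℝ}

theorem toSphere_mul_sphereEq (f : MvPolynomial (Fin 3) ℝ) :
    toSphere s (f * sphereEq (s ^ 2)) = 0 :=
  Ideal.Quotient.eq_zero_iff_mem.2
    (Ideal.mul_mem_left _ _ (Ideal.subset_span (Set.mem_singleton _)))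

theorem pbS_toSphere (f g : MvPolynomial (Fin 3) ℝ) :
    pbS s (toSphere s f) (toSphere s g) = toSphere s (ham f g) := by
  have hrep : ∀ h, ∃ a, rep s (toSphere s h) = h + a * sphereEq (s ^ 2) := by
    intro h
    have hspec : toSphere s (rep s (toSphere s h)) = toSphere s h :=
      (Ideal.Quotient.mk_surjective (I := sphereIdeal s) (toSphere s h)).choose_spec
    obtain ⟨a, ha⟩ := Ideal.mem_span_singleton'.1 (Ideal.Quotient.eq.1 hspec)
    exact ⟨a, by rw [sphereEq, ha]; ring⟩
  obtain ⟨a, ha⟩ := hrep f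
  obtain ⟨b, hb⟩ := hrep g
  have e : ham (f + a * sphereEq (s ^ 2)) (g + b * sphereEq (s ^ 2)) =
      ham f g + (ham f b + ham a (g + b * sphereEq (s ^ 2))) * sphereEq (s ^ 2) := by
    rw [ham_add_left, ham_mul_left, ham_skew (sphereEq _), ham_sphereEq, map_add (ham f),
      ham_mul_right, ham_sphereEq]
    ring
  rw [pbS, pb_eq_ham, ha, hb, e, map_add, toSphere_mul_sphereEq, add_zero]

/-- The polynomials whose restriction to the sphere lies in `V`. -/
def preimage (V : Submodule ℝ (SpherePoly s)) : Submodule ℝ (MvPolynomial (Fin 3) ℝ) :=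
  V.comap (Ideal.Quotient.mkₐ ℝ (sphereIdeal s)).toLinearMap

theorem mem_preimage {V : Submodule ℝ (SpherePoly s)} {f : MvPolynomial (Fin 3) ℝ} :
    f ∈ preimage V ↔ toSphere s f ∈ V := Iff.rfl

theorem mul_sphereEq_mem_complexify_preimage (V : Submodule ℝ (SpherePoly s))
    (f : MvPolynomial (Fin 3) ℂ) :
    f * sphereEq ((s ^ 2 : ℝ) : ℂ) ∈ complexify (preimage V) :=
  mul_sphereEq_mem_complexify
    (fun a => by rw [mem_preimage, toSphere_mul_sphereEq]; exact V.zero_mem) f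

theorem X_mem_complexify_preimage {V : Submodule ℝ (SpherePoly s)} (h : P1 s ≤ V) (i : Fin 3) :
    X i ∈ complexify (preimage V) := by
  rw [← map_X Complex.ofRealHom, map_mem_complexify]
  exact h (S_mem_P1 s i)

theorem toSphere_mem_of_odd (hs : 0 < s) {V : Submodule ℝ (SpherePoly s)}
    (hV : ∀ p ∈ V, ∀ q ∈ V, pbS s p q ∈ V) (h1 : P1 s ≤ V) (hne : V ≠ P1 s)
    {g : MvPolynomial (Fin 3) ℝ} {l : ℕ} (hl : Odd l) (hg : g.IsHomogeneous l) :
    toSphere s g ∈ V := by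
  obtain ⟨p, hpV, hp1⟩ := SetLike.exists_of_lt (lt_of_le_of_ne h1 hne.symm)
  obtain ⟨f, rfl⟩ := Ideal.Quotient.mk_surjective p
  have hham : ∀ a ∈ preimage V, ∀ b ∈ preimage V, ham a b ∈ preimage V := by
    intro a ha b hb
    rw [mem_preimage, ← pbS_toSphere]
    exact hV _ ha _ hb
  have hU : IsSphereSubalgebra ((s ^ 2 : ℝ) : ℂ) (complexify (preimage V)) :=
    ⟨ham_mem_complexify hham, X_mem_complexify_preimage h1,
      mul_sphereEq_mem_complexify_preimage V⟩
  have hone : (1 : MvPolynomial (Fin 3) ℂ) ∈ complexify (preimage (P1 s)) := by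
    rw [← map_one (map Complex.ofRealHom), map_mem_complexify, mem_preimage, map_one]
    exact one_mem_P1 s
  exact map_mem_complexify.1 (hU.odd_homogeneous_mem (by exact_mod_cast (pow_pos hs 2).ne')
    (fun _ => conj_mem_complexify) (mul_sphereEq_mem_complexify_preimage (P1 s)) hone
    (X_mem_complexify_preimage le_rfl) (map_mem_complexify.2 (mem_preimage.2 hpV))
    (fun h => hp1 (mem_preimage.1 (map_mem_complexify.1 h))) hl (hg.map _))

end Quotient

/-- `P¹` is a maximal Poisson subalgebra of `Õ` (Proposition 2.3). -/
theorem P1_maximal_in_Otilde (s : ℝ) (hs : 0 < s)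
    (Vs : Submodule ℝ (SpherePoly s))
    (hpoisson : ∀ p ∈ Vs, ∀ q ∈ Vs, pbS s p q ∈ Vs)
    (h1 : P1 s ≤ Vs) (h2 : Vs ≤ Otilde s) :
    Vs = P1 s ∨ Vs = Otilde s := by
  refine or_iff_not_imp_left.2 fun hne => le_antisymm h2 (sup_le ?_ (iSup₂_le fun l hl => ?_))
  · rw [Submodule.span_singleton_le_iff_mem]
    exact h1 (one_mem_P1 s)
  · rintro _ ⟨g, ⟨hg, -⟩, rfl⟩
    exact toSphere_mem_of_odd hs hpoisson h1 hne hl hg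

end
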